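/- arXiv:2110.09906 — 2 statements merged into one kernel-verified Lean document; each statement's English description precedes it below -/
import Mathlib

section
/- Let n be a positive integer. Then in ℚ(q), ∑_{k=0}^{n-1} q^{-k} ∑_{j=1}^{k} q^j/(1-q^j)^2 ≡ (1/(q^{n-1}(q-1))) · ( (n-1)/2 + (n-1)(n-3)(1-q^n)/8 ) (mod Φ_n(q)^2). -/
open Finset Polynomial

/-- The variable `q` of the field of rational functions `ℚ(q)`. -/
noncomputable def q : RatFunc ℚ := RatFunc.X

/-- The `q`-shifted factorial `(q;q)_m = ∏_{i=1}^{m} (1 - q^i)` as an element of `ℚ(q)`. -/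
noncomputable def qPoch (m : ℕ) : RatFunc ℚ := ∏ i ∈ Finset.range m, (1 - q ^ (i + 1))

/-- The Gaussian `q`-binomial coefficient `[m choose k]_q`, viewed in `ℚ(q)`. -/
noncomputable def qbinom (m k : ℕ) : RatFunc ℚ :=
  if k ≤ m then qPoch m / (qPoch k * qPoch (m - k)) else 0

/-- The `q`-integer `[n] = 1 + q + ⋯ + q^{n-1}` as a polynomial in `ℚ[q]`. -/
noncomputable def qint (n : ℕ) : Polynomial ℚ := ∑ i ∈ Finset.range n, Polynomial.X ^ i

/-- The `q`-integer `[n]` viewed in `ℚ(q)`. -/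
noncomputable def qintR (n : ℕ) : RatFunc ℚ :=
  algebraMap (Polynomial ℚ) (RatFunc ℚ) (qint n)

/-- `A ≡ B (mod P)` for rational functions `A, B ∈ ℚ(q)` and a polynomial `P`:
`A - B` can be written as a fraction `a / b` of polynomials whose numerator `a` is
divisible by `P` and whose denominator `b` is coprime to `P`. -/
def ratModEq (P : Polynomial ℚ) (A B : RatFunc ℚ) : Prop :=
  ∃ a b : Polynomial ℚ, IsCoprime b P ∧ P ∣ a ∧
    A - B = algebraMap (Polynomial ℚ) (RatFunc ℚ) a / algebraMap (Polynomial ℚ) (RatFunc ℚ) b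

/-- `A` is a quotient of rational polynomials whose denominator does not vanish at `z`, and its
value at `z` is `c`. -/
def EvalsTo (z : ℂ) (A : RatFunc ℚ) (c : ℂ) : Prop :=
  ∃ a b : ℚ[X], aeval z b ≠ 0 ∧
    A = algebraMap ℚ[X] (RatFunc ℚ) a / algebraMap ℚ[X] (RatFunc ℚ) b ∧
    aeval z a = c * aeval z b

namespace EvalsTo

variable {z : ℂ} {A B : RatFunc ℚ} {c d : ℂ}

lemma algebraMap_ne_zero {b : ℚ[X]} (h : aeval z b ≠ 0) :
    algebraMap ℚ[X] (RatFunc ℚ) b ≠ 0 :=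
  RatFunc.algebraMap_ne_zero fun h0 => h (by simp [h0])

lemma poly (p : ℚ[X]) : EvalsTo z (algebraMap ℚ[X] (RatFunc ℚ) p) (aeval z p) :=
  ⟨p, 1, by simp, by simp, by simp⟩

lemma q : EvalsTo z q z := by
  simpa [_root_.q] using poly (z := z) X

lemma const (r : ℚ) : EvalsTo z (RatFunc.C r) (r : ℂ) := by
  simpa using poly (z := z) (Polynomial.C r)

lemma one : EvalsTo z 1 1 := by
  simpa using poly (z := z) 1

lemma add (hA : EvalsTo z A c) (hB : EvalsTo z B d) : EvalsTo z (A + B) (c + d) := by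
  obtain ⟨a, b, hb, rfl, h⟩ := hA
  obtain ⟨a', b', hb', rfl, h'⟩ := hB
  refine ⟨a * b' + b * a', b * b', by simp [hb, hb'], ?_, ?_⟩
  · rw [div_add_div _ _ (algebraMap_ne_zero hb) (algebraMap_ne_zero hb')]
    simp only [map_add, map_mul]
  · simp only [map_add, map_mul, h, h']
    ring

lemma mul (hA : EvalsTo z A c) (hB : EvalsTo z B d) : EvalsTo z (A * B) (c * d) := by
  obtain ⟨a, b, hb, rfl, h⟩ := hA
  obtain ⟨a', b', hb', rfl, h'⟩ := hB
  refine ⟨a * a', b * b', by simp [hb, hb'], ?_, ?_⟩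
  · rw [div_mul_div_comm]
    simp only [map_mul]
  · simp only [map_mul, h, h']
    ring

lemma sub (hA : EvalsTo z A c) (hB : EvalsTo z B d) : EvalsTo z (A - B) (c - d) := by
  have h := hA.add ((const (z := z) (-1)).mul hB)
  simpa [sub_eq_add_neg] using h

lemma inv (hA : EvalsTo z A c) (hc : c ≠ 0) : EvalsTo z A⁻¹ c⁻¹ := by
  obtain ⟨a, b, hb, rfl, h⟩ := hA
  exact ⟨b, a, by simp [h, hc, hb], by rw [inv_div], by rw [h]; field_simp⟩

lemma pow (hA : EvalsTo z A c) (k : ℕ) : EvalsTo z (A ^ k) (c ^ k) := by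
  induction k with
  | zero => simpa using one
  | succ k ih => simpa only [pow_succ] using ih.mul hA

lemma sum {ι : Type*} (s : Finset ι) {A : ι → RatFunc ℚ} {c : ι → ℂ}
    (h : ∀ i ∈ s, EvalsTo z (A i) (c i)) : EvalsTo z (∑ i ∈ s, A i) (∑ i ∈ s, c i) := by
  classical
  induction s using Finset.induction_on with
  | empty => simpa using const (z := z) 0
  | insert i s hi ih =>
    rw [Finset.sum_insert hi, Finset.sum_insert hi]
    exact (h i (Finset.mem_insert_self i s)).add
      (ih fun j hj => h j (Finset.mem_insert_of_mem hj))

end EvalsTo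

lemma cyclotomic_dvd_iff_aeval_eq_zero {n : ℕ} (hn : 0 < n) {z : ℂ} (hz : IsPrimitiveRoot z n)
    (p : ℚ[X]) : cyclotomic n ℚ ∣ p ↔ aeval z p = 0 := by
  rw [cyclotomic_eq_minpoly_rat hz hn, minpoly.dvd_iff]

/-- A factor `1 - q ^ n` and a factor vanishing at a primitive `n`-th root of unity together give
divisibility by `Φ_n(q) ^ 2`. -/
lemma ratModEq_of_sub_eq_mul {n : ℕ} (hn : 0 < n) {z : ℂ} (hz : IsPrimitiveRoot z n)
    {A B T : RatFunc ℚ} (hT : EvalsTo z T 0) (h : A - B = (1 - q ^ n) * T) :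
    ratModEq (cyclotomic n ℚ ^ 2) A B := by
  obtain ⟨a, b, hb, rfl, ha⟩ := hT
  rw [zero_mul] at ha
  refine ⟨(1 - X ^ n) * a, b, ?_, ?_, ?_⟩
  · refine IsCoprime.pow_right (IsCoprime.symm ?_)
    rw [(cyclotomic.irreducible_rat hn).coprime_iff_not_dvd,
      cyclotomic_dvd_iff_aeval_eq_zero hn hz]
    exact hb
  · rw [sq]
    refine mul_dvd_mul ?_ ?_ <;> rw [cyclotomic_dvd_iff_aeval_eq_zero hn hz]
    · simp [hz.pow_eq_one]
    · exact ha
  · rw [h]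
    simp [q, mul_div_assoc]

lemma sum_quadratic_mul_pow {K : Type*} [Field K] (a b x : K) (n : ℕ) :
    (1 - x) ^ 3 * ∑ k ∈ Finset.range n, (a * k ^ 2 + b * k) * x ^ k =
      x * (b * (1 - x) + 2 * x * a + a * (1 - x)) -
        (a * (1 - x) ^ 2 * n ^ 2 + (b * (1 - x) ^ 2 + 2 * x * a * (1 - x)) * n +
          x * (b * (1 - x) + 2 * x * a + a * (1 - x))) * x ^ n := by
  induction n with
  | zero => simp
  | succ n ih =>
    rw [Finset.sum_range_succ, mul_add, ih]
    push_cast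
    ring

/-- Expansion of `x ↦ 1 / (2 (1 - x) (1 - x⁻¹)) - 1 / (1 - x) ^ 2` on the nontrivial `n`-th roots
of unity as a polynomial in `x`. -/
lemma rootOfUnity_expansion {K : Type*} [Field K] [CharZero K] {n : ℕ} (hn : 0 < n) {x y : K}
    (hx : x ^ n = 1) (hx1 : x ≠ 1) (hxy : x * y = 1) :
    2⁻¹ * ((1 - x)⁻¹ * (1 - y)⁻¹) - ((1 - x)⁻¹) ^ 2 =
      ∑ k ∈ Finset.range n, (4 * (n : K))⁻¹ * (3 * k ^ 2 + (4 - 3 * n) * k) * x ^ k := by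
  have h := sum_quadratic_mul_pow 3 (4 - 3 * (n : K)) x n
  rw [hx] at h
  have hn' : (n : K) ≠ 0 := by exact_mod_cast hn.ne'
  have h1 : 1 - x ≠ 0 := sub_ne_zero.2 hx1.symm
  have hx0 : x ≠ 0 := left_ne_zero_of_mul_eq_one hxy
  have hy : (1 - y)⁻¹ = -x * (1 - x)⁻¹ := by
    have : 1 - y = -(1 - x) * x⁻¹ := by
      rw [eq_inv_of_mul_eq_one_right hxy]
      field_simp
      ring
    rw [this, mul_inv, inv_neg, inv_inv]
    ring
  simp_rw [mul_assoc, ← Finset.mul_sum, mul_inv]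
  rw [hy]
  refine mul_left_cancel₀ (pow_ne_zero 3 h1) ?_
  rw [mul_left_comm, mul_left_comm ((1 - x) ^ 3), h]
  field_simp
  ring

lemma sum_pow_mul_Icc {K : Type*} [Field K] {m k : ℕ} {z : K} (hz : IsPrimitiveRoot z (m + 1))
    (hk0 : k ≠ 0) (hk : k < m + 1) : ∑ j ∈ Finset.Icc 1 m, (z ^ j) ^ k = -1 := by
  have h1 : z ^ k ≠ 1 := hz.pow_ne_one_of_pos_of_lt hk0 hk
  have h := mul_neg_geom_sum (z ^ k) (m + 1)
  rw [← pow_mul, mul_comm k, pow_mul, hz.pow_eq_one, one_pow, sub_self] at h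
  have h2 := (mul_eq_zero.1 h).resolve_left (sub_ne_zero.2 h1.symm)
  rw [Finset.range_eq_Ico, Finset.sum_eq_sum_Ico_succ_bot (Nat.succ_pos m), pow_zero] at h2
  rw [← Finset.Ico_add_one_right_eq_Icc]
  simp_rw [← pow_mul, mul_comm _ k, pow_mul]
  exact eq_neg_of_add_eq_zero_right h2

lemma sum_quadratic {K : Type*} [Field K] [CharZero K] (a b : K) (n : ℕ) :
    ∑ k ∈ Finset.range n, (a * (k : K) ^ 2 + b * k) =
      a * (n * (n - 1) * (2 * n - 1) / 6) + b * (n * (n - 1) / 2) := by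
  induction n with
  | zero => simp
  | succ n ih =>
    rw [Finset.sum_range_succ, ih]
    push_cast
    ring

lemma primitiveRoot_sum {K : Type*} [Field K] [CharZero K] {m : ℕ} {z : K}
    (hz : IsPrimitiveRoot z (m + 1)) :
    ∑ j ∈ Finset.Icc 1 m,
      (2⁻¹ * ((1 - z ^ j)⁻¹ * (1 - z ^ (m + 1 - j))⁻¹) - ((1 - z ^ j)⁻¹) ^ 2) =
      (m : K) * (m - 2) / 8 := by
  have hm : (m : K) + 1 ≠ 0 := by exact_mod_cast m.succ_ne_zero
  calc
    _ = ∑ j ∈ Finset.Icc 1 m, ∑ k ∈ Finset.range (m + 1),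
        (4 * ((m + 1 : ℕ) : K))⁻¹ * (3 * k ^ 2 + (4 - 3 * (m + 1 : ℕ)) * k) * (z ^ j) ^ k := by
      refine Finset.sum_congr rfl fun j hj => ?_
      rw [Finset.mem_Icc] at hj
      refine rootOfUnity_expansion m.succ_pos ?_ ?_ ?_
      · rw [← pow_mul, mul_comm, pow_mul, hz.pow_eq_one, one_pow]
      · exact hz.pow_ne_one_of_pos_of_lt (by omega) (by omega)
      · rw [← pow_add, Nat.add_sub_cancel' (by omega), hz.pow_eq_one]
    _ = ∑ k ∈ Finset.range (m + 1),
        (4 * ((m + 1 : ℕ) : K))⁻¹ * (3 * k ^ 2 + (4 - 3 * (m + 1 : ℕ)) * k) * -1 := by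
      rw [Finset.sum_comm]
      refine Finset.sum_congr rfl fun k hk => ?_
      rw [← Finset.mul_sum]
      rcases eq_or_ne k 0 with rfl | hk0
      · simp
      · rw [sum_pow_mul_Icc hz hk0 (Finset.mem_range.1 hk)]
    _ = _ := by
      rw [← Finset.sum_mul, ← Finset.mul_sum, sum_quadratic]
      push_cast
      field_simp
      ring

lemma double_sum_mul {K : Type*} [Field K] {x : K} (hx : x ≠ 0) (f : ℕ → K) (m : ℕ) :
    x ^ m * (x - 1) * ∑ k ∈ Finset.range (m + 1), x ^ (-(k : ℤ)) * ∑ j ∈ Finset.Icc 1 k, f j =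
      ∑ j ∈ Finset.Icc 1 m, (x ^ (m + 1 - j) - 1) * f j := by
  induction m with
  | zero => simp
  | succ m ih =>
    have h : ∑ j ∈ Finset.Icc 1 (m + 1), (x ^ (m + 1 + 1 - j) - 1) * f j =
        x * ∑ j ∈ Finset.Icc 1 (m + 1), (x ^ (m + 1 - j) - 1) * f j +
          (x - 1) * ∑ j ∈ Finset.Icc 1 (m + 1), f j := by
      rw [Finset.mul_sum, Finset.mul_sum, ← Finset.sum_add_distrib]
      refine Finset.sum_congr rfl fun j hj => ?_
      rw [Nat.sub_add_comm (Finset.mem_Icc.1 hj).2, pow_succ]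
      ring
    rw [h, Finset.sum_Icc_succ_top (b := m) (by omega) (fun j => (x ^ (m + 1 - j) - 1) * f j),
      Nat.sub_self, pow_zero, sub_self, zero_mul, add_zero, ← ih, Finset.sum_range_succ, mul_add,
      zpow_neg, zpow_natCast]
    field_simp
    ring

lemma sum_Icc_one_reflect {K : Type*} [Field K] (g : ℕ → K) (m : ℕ) :
    ∑ j ∈ Finset.Icc 1 m, g (m + 1 - j) = ∑ j ∈ Finset.Icc 1 m, g j := by
  refine Finset.sum_nbij' (fun j => m + 1 - j) (fun j => m + 1 - j) ?_ ?_ ?_ ?_ ?_ <;>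
    intro j hj <;> simp only [Finset.mem_Icc] at * <;> omega

lemma one_sub_q_pow_ne_zero {j : ℕ} (hj : j ≠ 0) : 1 - q ^ j ≠ 0 := by
  have h : (X ^ j - Polynomial.C (1 : ℚ)) ≠ 0 := X_pow_sub_C_ne_zero (Nat.pos_of_ne_zero hj) 1
  intro h0
  refine RatFunc.algebraMap_ne_zero h ?_
  rw [map_sub, map_pow, RatFunc.algebraMap_X, RatFunc.algebraMap_C, map_one]
  exact sub_eq_zero.2 (sub_eq_zero.1 h0).symm

/-- Pairing `j` with `m + 1 - j` extracts a factor `1 - x ^ (m + 1)`. -/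
lemma sum_eq_half_add_mul {K : Type*} [Field K] [CharZero K] {x : K} {m : ℕ}
    (hx : ∀ j, j ≠ 0 → 1 - x ^ j ≠ 0) :
    ∑ j ∈ Finset.Icc 1 m, (x ^ (m + 1 - j) - 1) * (x ^ j / (1 - x ^ j) ^ 2) =
      m / 2 + (1 - x ^ (m + 1)) * ∑ j ∈ Finset.Icc 1 m,
        (2⁻¹ * ((1 - x ^ j)⁻¹ * (1 - x ^ (m + 1 - j))⁻¹) - ((1 - x ^ j)⁻¹) ^ 2) := by
  have hpair : ∑ j ∈ Finset.Icc 1 m, ((1 - x ^ j)⁻¹ - (1 - x ^ (m + 1 - j))⁻¹) = 0 := by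
    rw [Finset.sum_sub_distrib, sum_Icc_one_reflect (fun j => (1 - x ^ j)⁻¹), sub_self]
  have hconst : (m : K) / 2 = ∑ _j ∈ Finset.Icc 1 m, (2⁻¹ : K) := by
    simp [div_eq_mul_inv]
  rw [hconst, Finset.mul_sum, ← Finset.sum_add_distrib, ← sub_eq_zero, ← Finset.sum_sub_distrib,
    ← mul_zero (2⁻¹ : K), ← hpair, Finset.mul_sum]
  refine Finset.sum_congr rfl fun j hj => ?_
  rw [Finset.mem_Icc] at hj
  have h1 := hx j (by omega)
  have h2 := hx (m + 1 - j) (by omega)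
  have h3 : x ^ (m + 1) = x ^ j * x ^ (m + 1 - j) := by
    rw [← pow_add, Nat.add_sub_cancel' (by omega)]
  rw [h3]
  field_simp
  ring

/-- Equation (2.6): for a positive integer `n`,
`∑_{k=0}^{n-1} q^{-k} ∑_{j=1}^k q^j/(1-q^j)²
  ≡ (1/(q^{n-1}(q-1))) ((n-1)/2 + (n-1)(n-3)(1-q^n)/8)  (mod Φ_n(q)²)`. -/
theorem double_sum_mod_cyclotomic_sq (n : ℕ) (hn : 0 < n) :
    ratModEq ((Polynomial.cyclotomic n ℚ) ^ 2)
      (∑ k ∈ Finset.range n, q ^ (-(k : ℤ)) *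
        ∑ j ∈ Finset.Icc 1 k, q ^ j / (1 - q ^ j) ^ 2)
      (1 / (q ^ (n - 1) * (q - 1)) *
        (RatFunc.C (((n : ℚ) - 1) / 2) +
          RatFunc.C (((n : ℚ) - 1) * ((n : ℚ) - 3) / 8) * (1 - q ^ n))) := by
  obtain ⟨m, rfl⟩ : ∃ m, n = m + 1 := ⟨n - 1, by omega⟩
  rcases Nat.eq_zero_or_pos m with rfl | hm
  · exact ⟨0, 1, isCoprime_one_left, dvd_zero _, by simp⟩
  have hz := Complex.isPrimitiveRoot_exp (m + 1) m.succ_ne_zero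
  set z := Complex.exp (2 * Real.pi * Complex.I / (m + 1 : ℕ))
  have hz1 : ∀ j, j ≠ 0 → j < m + 1 → 1 - z ^ j ≠ 0 := fun j h0 h =>
    sub_ne_zero.2 (hz.pow_ne_one_of_pos_of_lt h0 h).symm
  have hq0 : q ≠ 0 := RatFunc.X_ne_zero
  have hq1 : q - 1 ≠ 0 := by
    simpa using sub_ne_zero.2 (sub_ne_zero.1 (one_sub_q_pow_ne_zero one_ne_zero)).symm
  have hS := double_sum_mul hq0 (fun j => q ^ j / (1 - q ^ j) ^ 2) m
  rw [sum_eq_half_add_mul fun j hj => one_sub_q_pow_ne_zero hj] at hS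
  set T := ∑ j ∈ Finset.Icc 1 m,
    (2⁻¹ * ((1 - q ^ j)⁻¹ * (1 - q ^ (m + 1 - j))⁻¹) - ((1 - q ^ j)⁻¹) ^ 2) with hTdef
  have hinv : ∀ j, j ≠ 0 → j < m + 1 → EvalsTo z (1 - q ^ j)⁻¹ (1 - z ^ j)⁻¹ := fun j h0 h =>
    (EvalsTo.one.sub (EvalsTo.q.pow j)).inv (hz1 j h0 h)
  have hT : EvalsTo z T ((m : ℂ) * (m - 2) / 8) := by
    rw [← primitiveRoot_sum hz]
    refine EvalsTo.sum _ fun j hj => ?_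
    rw [Finset.mem_Icc] at hj
    have h2 : EvalsTo z 2⁻¹ 2⁻¹ := by simpa using EvalsTo.const (z := z) 2⁻¹
    have hj' := hinv j (by omega) (by omega)
    exact (h2.mul (hj'.mul (hinv (m + 1 - j) (by omega) (by omega)))).sub (hj'.pow 2)
  have hpref : EvalsTo z (q ^ m * (q - 1))⁻¹ (z ^ m * (z - 1))⁻¹ := by
    refine ((EvalsTo.q.pow m).mul (EvalsTo.q.sub EvalsTo.one)).inv (mul_ne_zero ?_ ?_)
    · exact pow_ne_zero m (hz.ne_zero m.succ_ne_zero)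
    · exact sub_ne_zero.2 (hz.ne_one (by omega))
  refine ratModEq_of_sub_eq_mul hn hz (T := (q ^ m * (q - 1))⁻¹ *
    (T - RatFunc.C (((m + 1 : ℕ) - 1 : ℚ) * ((m + 1 : ℕ) - 3) / 8))) ?_ ?_
  · convert hpref.mul (hT.sub (EvalsTo.const _)) using 1
    push_cast
    ring
  · have hC : RatFunc.C (((m + 1 : ℕ) - 1 : ℚ) / 2) = (m : RatFunc ℚ) / 2 := by
      simp
    rw [eq_div_of_mul_eq (mul_ne_zero (pow_ne_zero m hq0) hq1) ((mul_comm _ _).trans hS), hC,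
      Nat.add_sub_cancel]
    ring
end

section
/- Let n be a positive integer and r an arbitrary integer. Then in ℚ(q), ∑_{k=0}^{n-1} q^{r(n-k)^2+(r-1)k} · [n+k choose k]_q^{2r} · [n-1 choose k]_q^{2r} ≡ q^{n(nr-1)+1}·[n] + 2r·q^{n(nr-2)+1}·(1-q)·[n]^2 · ( (n-1)/2 + (n-1)(n-3)(1-q)[n]/8 ) (mod Φ_n(q)^4). -/
open Finset Polynomial

theorem one_sub_mul_sum_range_mul_pow {A : Type*} [CommRing A] (z : A) (m : ℕ) :
    (1 - z) * ∑ k ∈ range m, (k : A) * z ^ k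
      = ∑ k ∈ range m, z ^ k - 1 - ((m : A) - 1) * z ^ m := by
  induction m with
  | zero => simp
  | succ m ih =>
    rw [sum_range_succ, mul_add, ih, sum_range_succ]
    push_cast
    ring

theorem one_sub_mul_sum_range_sq_mul_pow {A : Type*} [CommRing A] (z : A) (m : ℕ) :
    (1 - z) * ∑ k ∈ range m, (k : A) ^ 2 * z ^ k
      = 2 * ∑ k ∈ range m, (k : A) * z ^ k - ∑ k ∈ range m, z ^ k + 1
        - ((m : A) - 1) ^ 2 * z ^ m := by
  induction m with
  | zero => simp
  | succ m ih =>
    rw [sum_range_succ, mul_add, ih, sum_range_succ, sum_range_succ]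
    push_cast
    ring

theorem six_mul_sum_range_succ_sq {A : Type*} [CommRing A] (N : ℕ) :
    6 * ∑ k ∈ range (N + 1), (k : A) ^ 2 = N * (N + 1) * (2 * N + 1) := by
  induction N with
  | zero => simp
  | succ N ih =>
    rw [sum_range_succ, mul_add, ih]
    push_cast
    ring

section RootOfUnity

variable {A : Type*} [CommRing A] {N : ℕ} {ζ : A} {y : ℕ → A}

theorem geom_sum_eq_zero_of_inverse {z w : A} {m : ℕ} (hz : z ^ m = 1) (hw : w * (1 - z) = 1) :
    ∑ k ∈ range m, z ^ k = 0 := by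
  have h := mul_neg_geom_sum z m
  rw [hz, sub_self] at h
  linear_combination w * h - (∑ k ∈ range m, z ^ k) * hw

theorem two_mul_sum_inverse_one_sub (hζ : ζ ^ (N + 1) = 1)
    (hy : ∀ i < N, y i * (1 - ζ ^ (i + 1)) = 1) :
    2 * ∑ i ∈ range N, y i = N := by
  have hpair : ∀ i ∈ range N, y i + y (N - 1 - i) = 1 := by
    intro i hi
    have hi := mem_range.1 hi
    have h1 := hy i hi
    have h2 := hy (N - 1 - i) (by omega)
    have h3 : ζ ^ (i + 1) * ζ ^ (N - 1 - i + 1) = 1 := by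
      rw [← pow_add, ← hζ]
      congr 1
      omega
    set a := ζ ^ (i + 1)
    set b := ζ ^ (N - 1 - i + 1)
    linear_combination (1 - y i) * h2 + (y (N - 1 - i) * (1 - b) - y (N - 1 - i)) * h1
      - y i * y (N - 1 - i) * h3
  have := sum_congr rfl hpair
  rw [sum_add_distrib, sum_range_reflect] at this
  simp only [sum_const, card_range, nsmul_eq_mul, mul_one] at this
  linear_combination this

theorem sum_sq_inverse_one_sub (hζ : ζ ^ (N + 1) = 1)
    (hy : ∀ i < N, y i * (1 - ζ ^ (i + 1)) = 1) :
    12 * ((N : A) + 1) * ∑ i ∈ range N, y i ^ 2 = N * (N + 1) * (4 - N) := by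
  have hE : ∀ i ∈ range N, ∑ k ∈ range (N + 1), (k : A) ^ 2 * (ζ ^ (i + 1)) ^ k
      = -2 * ((N : A) + 1) * y i ^ 2 + (1 - (N : A) ^ 2) * y i := by
    intro i hi
    have hi := hy i (mem_range.1 hi)
    have hz : (ζ ^ (i + 1)) ^ (N + 1) = 1 := by rw [← pow_mul, mul_comm, pow_mul, hζ, one_pow]
    have h0 := geom_sum_eq_zero_of_inverse hz hi
    have h1 := one_sub_mul_sum_range_mul_pow (ζ ^ (i + 1)) (N + 1)
    have h2 := one_sub_mul_sum_range_sq_mul_pow (ζ ^ (i + 1)) (N + 1)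
    rw [h0, hz] at h1 h2
    push_cast at h1 h2
    set D := ∑ k ∈ range (N + 1), (k : A) * (ζ ^ (i + 1)) ^ k
    set E := ∑ k ∈ range (N + 1), (k : A) ^ 2 * (ζ ^ (i + 1)) ^ k
    linear_combination y i * h2 - E * hi + 2 * y i * (y i * h1 - D * hi)
  have hsum := sum_congr rfl hE
  rw [sum_comm, sum_add_distrib, ← mul_sum, ← mul_sum] at hsum
  have hF : ∀ k ∈ range (N + 1),
      ∑ i ∈ range N, (k : A) ^ 2 * (ζ ^ (i + 1)) ^ k = -(k : A) ^ 2 := by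
    intro k hk
    rcases Nat.eq_zero_or_pos k with rfl | hk0
    · simp
    have hk := mem_range.1 hk
    have hi := hy (k - 1) (by omega)
    rw [Nat.sub_add_cancel hk0] at hi
    have hz : (ζ ^ k) ^ (N + 1) = 1 := by rw [← pow_mul, mul_comm, pow_mul, hζ, one_pow]
    have h0 := geom_sum_eq_zero_of_inverse hz hi
    rw [sum_range_succ', pow_zero] at h0
    rw [← mul_sum]
    simp only [← pow_mul, mul_comm _ k] at h0 ⊢
    linear_combination (k : A) ^ 2 * h0
  rw [sum_congr rfl hF, sum_neg_distrib] at hsum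
  have h6 := six_mul_sum_range_succ_sq (A := A) N
  have h2 := two_mul_sum_inverse_one_sub hζ hy
  linear_combination 6 * hsum + h6 + (3 : A) * (1 - (N : A) ^ 2) * h2

end RootOfUnity

/-- `u = 1 - t² c + O(t⁴)` over the subring `O`, with `u` a unit of `O`. -/
def HasExpansion {K : Type*} [Field K] (O : Subring K) (t u c : K) : Prop :=
  u ≠ 0 ∧ u⁻¹ ∈ O ∧ c ∈ O ∧ ∃ h ∈ O, u = 1 - t ^ 2 * c + t ^ 4 * h

namespace HasExpansion

variable {K : Type*} [Field K] {O : Subring K} {t u v c d : K}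

theorem one : HasExpansion O t 1 0 :=
  ⟨one_ne_zero, by simp [O.one_mem], O.zero_mem, 0, O.zero_mem, by ring⟩

theorem mul (ht : t ∈ O) (hu : HasExpansion O t u c) (hv : HasExpansion O t v d) :
    HasExpansion O t (u * v) (c + d) := by
  obtain ⟨hu0, hui, hc, h, hh, hu⟩ := hu
  obtain ⟨hv0, hvi, hd, k, hk, hv⟩ := hv
  refine ⟨mul_ne_zero hu0 hv0, ?_, add_mem hc hd,
    c * d + h + k - t ^ 2 * (c * k + d * h) + t ^ 4 * (h * k), ?_, ?_⟩
  · rw [mul_inv]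
    exact mul_mem hui hvi
  · exact add_mem (sub_mem (add_mem (add_mem (mul_mem hc hd) hh) hk)
      (mul_mem (pow_mem ht 2) (add_mem (mul_mem hc hk) (mul_mem hd hh))))
      (mul_mem (pow_mem ht 4) (mul_mem hh hk))
  · rw [hu, hv]
    ring

theorem inv (ht : t ∈ O) (hu : HasExpansion O t u c) : HasExpansion O t u⁻¹ (-c) := by
  obtain ⟨hu0, hui, hc, h, hh, hu⟩ := hu
  have huO : u ∈ O := by
    rw [hu]
    exact add_mem (sub_mem O.one_mem (mul_mem (pow_mem ht 2) hc)) (mul_mem (pow_mem ht 4) hh)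
  refine ⟨inv_ne_zero hu0, by rwa [inv_inv], neg_mem hc,
    u⁻¹ * (c ^ 2 - h * (1 + t ^ 2 * c)), ?_, ?_⟩
  · exact mul_mem hui (sub_mem (pow_mem hc 2)
      (mul_mem hh (add_mem O.one_mem (mul_mem (pow_mem ht 2) hc))))
  · refine mul_left_cancel₀ hu0 ?_
    linear_combination (1 - t ^ 4 * (c ^ 2 - h * (1 + t ^ 2 * c))) * mul_inv_cancel₀ hu0
      - (1 + t ^ 2 * c) * hu

theorem pow (ht : t ∈ O) (hu : HasExpansion O t u c) (m : ℕ) :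
    HasExpansion O t (u ^ m) (m * c) := by
  induction m with
  | zero => simpa using one
  | succ m ih =>
    rw [pow_succ]
    convert ih.mul ht hu using 1
    push_cast
    ring

theorem zpow (ht : t ∈ O) (hu : HasExpansion O t u c) (m : ℤ) :
    HasExpansion O t (u ^ m) (m * c) := by
  obtain ⟨m, rfl | rfl⟩ := m.eq_nat_or_neg
  · simpa using hu.pow ht m
  · simpa using (hu.pow ht m).inv ht

theorem prod_range {u c : ℕ → K} (ht : t ∈ O) {k : ℕ}
    (h : ∀ i < k, HasExpansion O t (u i) (c i)) :
    HasExpansion O t (∏ i ∈ range k, u i) (∑ i ∈ range k, c i) := by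
  induction k with
  | zero => simpa using one
  | succ k ih =>
    rw [prod_range_succ, sum_range_succ]
    exact (ih fun i hi => h i (by omega)).mul ht (h k (by omega))

end HasExpansion

section Regular

variable {K : Type*} [Field K] [CharZero K] {O : Subring K} {q : K} {N : ℕ}

/-- The sum of squares of the inverses of `1 - q ^ j` for `0 < j < n`, modulo `1 - q ^ n`. -/
theorem exists_sum_sq_inv_eq (hqO : q ∈ O) (hQ : ∀ c : ℚ, (c : K) ∈ O)
    (hne : ∀ i, 1 - q ^ (i + 1) ≠ 0) (hinv : ∀ i < N, (1 - q ^ (i + 1))⁻¹ ∈ O) :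
    ∃ G ∈ O, ∑ i ∈ range N, (1 - q ^ (i + 1))⁻¹ ^ 2
      = (N : K) * (4 - N) / 12 + (1 - q ^ (N + 1)) * G := by
  have htO : 1 - q ^ (N + 1) ∈ O := sub_mem O.one_mem (pow_mem hqO _)
  let t : O := ⟨1 - q ^ (N + 1), htO⟩
  let Y : ℕ → O := fun i => if h : i < N then ⟨(1 - q ^ (i + 1))⁻¹, hinv i h⟩ else 0
  have hY : ∀ i < N, (Y i : K) = (1 - q ^ (i + 1))⁻¹ := fun i hi => by simp [Y, hi]
  let φ := Ideal.Quotient.mk (Ideal.span {t})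
  have hζ : φ ⟨q, hqO⟩ ^ (N + 1) = 1 := by
    rw [← map_pow, ← map_one φ, Ideal.Quotient.mk_eq_mk_iff_sub_mem, Ideal.mem_span_singleton]
    refine ⟨-1, Subtype.ext ?_⟩
    simp [t]
  have hy : ∀ i < N, φ (Y i) * (1 - φ ⟨q, hqO⟩ ^ (i + 1)) = 1 := by
    intro i hi
    rw [← map_pow, ← map_one φ, ← map_sub, ← map_mul]
    congr 1
    refine Subtype.ext ?_
    simp [hY i hi, hne i]
  have key := sum_sq_inverse_one_sub (y := fun i => φ (Y i)) hζ hy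
  have key2 : φ (12 * ((N : O) + 1) * ∑ i ∈ range N, Y i ^ 2) = φ (N * (N + 1) * (4 - N)) := by
    have h12 : φ 12 = 12 := map_ofNat φ 12
    have h4 : φ 4 = 4 := map_ofNat φ 4
    simpa [h12, h4] using key
  rw [Ideal.Quotient.mk_eq_mk_iff_sub_mem, Ideal.mem_span_singleton] at key2
  obtain ⟨g, hg⟩ := key2
  have hN : (N : K) + 1 ≠ 0 := by exact_mod_cast N.succ_ne_zero
  refine ⟨g * ((1 / (12 * ((N : ℚ) + 1)) : ℚ) : K), mul_mem g.2 (hQ _), ?_⟩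
  have hg' := congrArg (Subtype.val) hg
  have hs : ((∑ i ∈ range N, Y i ^ 2 : O) : K) = ∑ i ∈ range N, (1 - q ^ (i + 1))⁻¹ ^ 2 := by
    push_cast
    exact sum_congr rfl fun i hi => by rw [hY i (mem_range.1 hi)]
  have h12 : ((12 : O) : K) = 12 := rfl
  have h4 : ((4 : O) : K) = 4 := rfl
  push_cast at hg' hs ⊢
  rw [hs, h12, h4] at hg'
  generalize ∑ i ∈ range N, (1 - q ^ (i + 1))⁻¹ ^ 2 = S at hg' ⊢
  field_simp
  simp only [t] at hg'
  linear_combination hg'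

/-- The inverses of `1 - q ^ j` enter the second-order term through this sum, which is evaluated
here modulo `(1 - q ^ n) ^ 2`. -/
theorem exists_sum_second_order_eq (hqO : q ∈ O) (hQ : ∀ c : ℚ, (c : K) ∈ O)
    (hne : ∀ i, 1 - q ^ (i + 1) ≠ 0) (hinv : ∀ i < N, (1 - q ^ (i + 1))⁻¹ ∈ O) :
    ∃ G ∈ O, ∑ i ∈ range N, (q ^ (i + 1) - q ^ (N + 1)) * (1 - q ^ (i + 1))⁻¹ ^ 2
      = -((N : K) / 2 + N * (N - 2) / 8 * (1 - q ^ (N + 1))) + (1 - q ^ (N + 1)) ^ 2 * G := by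
  obtain ⟨G, hG, hs2⟩ := exists_sum_sq_inv_eq hqO hQ hne hinv
  set t := 1 - q ^ (N + 1) with ht
  set y : ℕ → K := fun i => (1 - q ^ (i + 1))⁻¹ with hy
  have hy1 : ∀ i, y i * (1 - q ^ (i + 1)) = 1 := fun i => inv_mul_cancel₀ (hne i)
  have hpair : ∀ i ∈ range N, y i + y (N - 1 - i) = 1 + t * (y i * y (N - 1 - i)) := by
    intro i hi
    have hi := mem_range.1 hi
    have h1 := hy1 i
    have h2 := hy1 (N - 1 - i)
    have h3 : q ^ (i + 1) * q ^ (N - 1 - i + 1) = q ^ (N + 1) := by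
      rw [← pow_add]
      congr 1
      omega
    rw [ht]
    linear_combination (1 - y i) * h2
      + (y (N - 1 - i) * (1 - q ^ (N - 1 - i + 1)) - y (N - 1 - i)) * h1
      - y i * y (N - 1 - i) * h3
  have hs1 := sum_congr rfl hpair
  rw [sum_add_distrib, sum_range_reflect, sum_add_distrib, ← mul_sum] at hs1
  have hprod : ∑ i ∈ range N, y i * y (N - 1 - i)
      = ∑ i ∈ range N, (y i + t * (y i ^ 2 * y (N - 1 - i)) - y i ^ 2) :=
    sum_congr rfl fun i hi => by linear_combination y i * hpair i hi
  rw [sum_sub_distrib, sum_add_distrib, ← mul_sum] at hprod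
  have hterm : ∑ i ∈ range N, (q ^ (i + 1) - q ^ (N + 1)) * (1 - q ^ (i + 1))⁻¹ ^ 2
      = ∑ i ∈ range N, (t * y i ^ 2 - y i) :=
    sum_congr rfl fun i _ => by
      rw [ht]
      linear_combination -(y i) * hy1 i
  rw [sum_sub_distrib, ← mul_sum] at hterm
  have hyO : ∀ i ∈ range N, y i ∈ O := fun i hi => hinv i (mem_range.1 hi)
  have hyO' : ∀ i ∈ range N, y (N - 1 - i) ∈ O := fun i hi =>
    hinv _ (by have := mem_range.1 hi; omega)
  have hYO : ∑ i ∈ range N, y i * y (N - 1 - i) ∈ O :=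
    sum_mem fun i hi => mul_mem (hyO i hi) (hyO' i hi)
  have hZO : ∑ i ∈ range N, y i ^ 2 * y (N - 1 - i) ∈ O :=
    sum_mem fun i hi => mul_mem (pow_mem (hyO i hi) 2) (hyO' i hi)
  simp only [sum_const, card_range, nsmul_eq_mul, mul_one] at hs1
  set s1 := ∑ i ∈ range N, y i
  set Y := ∑ i ∈ range N, y i * y (N - 1 - i)
  set Z := ∑ i ∈ range N, y i ^ 2 * y (N - 1 - i)
  refine ⟨((3 / 2 : ℚ) : K) * G - ((1 / 4 : ℚ) : K) * Y - ((1 / 2 : ℚ) : K) * Z,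
    sub_mem (sub_mem (mul_mem (hQ _) hG) (mul_mem (hQ _) hYO)) (mul_mem (hQ _) hZO), ?_⟩
  rw [hterm]
  push_cast
  linear_combination (t * 3 / 2) * hs2 - (1 / 2 + t / 4) * hs1 - t / 2 * hprod

theorem zpow_mem_of_inv_mem {K : Type*} [Field K] {O : Subring K} {q : K} (hqO : q ∈ O)
    (hqi : q⁻¹ ∈ O) (m : ℤ) : q ^ m ∈ O := by
  obtain ⟨m, rfl | rfl⟩ := m.eq_nat_or_neg
  · simpa using pow_mem hqO m
  · simpa using pow_mem hqi m

theorem one_sub_mul_sum_range_inv_pow {K : Type*} [Field K] {q : K} (hq0 : q ≠ 0) (m : ℕ) :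
    (1 - q) * ∑ k ∈ range m, q⁻¹ ^ k = q * (q⁻¹ ^ m - 1) := by
  induction m with
  | zero => simp
  | succ m ih =>
    rw [sum_range_succ, mul_add, ih, pow_succ]
    linear_combination -(q⁻¹ ^ m) * mul_inv_cancel₀ hq0

theorem one_sub_mul_sum_range_inv_pow_mul_sum {K : Type*} [Field K] {q : K} (hq0 : q ≠ 0)
    (c : ℕ → K) (N : ℕ) :
    (1 - q) * ∑ k ∈ range (N + 1), q⁻¹ ^ k * ∑ i ∈ range k, c i
      = ∑ i ∈ range N, c i * (q * (q⁻¹ ^ (N + 1) - q⁻¹ ^ (i + 1))) := by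
  induction N with
  | zero => simp
  | succ N ih =>
    rw [sum_range_succ, mul_add, ih, sum_range_succ _ N, sum_range_succ _ N, mul_add, mul_add,
      mul_sum, mul_sum, ← add_assoc, ← sum_add_distrib]
    congr 1
    · refine sum_congr rfl fun i _ => ?_
      rw [pow_succ _ (N + 1)]
      linear_combination -(q⁻¹ ^ (N + 1)) * c i * mul_inv_cancel₀ hq0
    · rw [pow_succ _ (N + 1)]
      linear_combination -(q⁻¹ ^ (N + 1)) * c N * mul_inv_cancel₀ hq0

/-- The factor of the product of binomials, up to a power of `q`, is a unit congruent to `1`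
modulo `(1 - q ^ n) ^ 2`. -/
theorem hasExpansion_factor (hq0 : q ≠ 0) (hqO : q ∈ O) (hqi : q⁻¹ ∈ O)
    (hne : ∀ i, 1 - q ^ (i + 1) ≠ 0) (hinv : ∀ j, ¬ N + 1 ∣ j → (1 - q ^ j)⁻¹ ∈ O)
    {i : ℕ} (hi : i < N) :
    (1 - q ^ (N + 1 + i + 1)) * (1 - q ^ (N - i)) / (1 - q ^ (i + 1)) ^ 2
        = -q ^ (N - i) * (1 - (1 - q ^ (N + 1)) ^ 2
          * (q ^ (i + 1) * q⁻¹ ^ (N + 1) * (1 - q ^ (i + 1))⁻¹ ^ 2)) ∧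
      HasExpansion O (1 - q ^ (N + 1))
        (1 - (1 - q ^ (N + 1)) ^ 2 * (q ^ (i + 1) * q⁻¹ ^ (N + 1) * (1 - q ^ (i + 1))⁻¹ ^ 2))
        (q ^ (i + 1) * q⁻¹ ^ (N + 1) * (1 - q ^ (i + 1))⁻¹ ^ 2) := by
  have hab : q ^ (i + 1) * q ^ (N - i) = q ^ (N + 1) := by
    rw [← pow_add]
    congr 1
    omega
  have hxa : q ^ (N + 1 + i + 1) = q ^ (N + 1) * q ^ (i + 1) := by
    rw [← pow_add]
    congr 1
  have hA := hne i
  have hb0 : 1 - q ^ (N - i) ≠ 0 := by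
    have := hne (N - i - 1)
    rwa [Nat.sub_add_cancel (by omega)] at this
  have hxa0 := hne (N + 1 + i)
  have hAi := hinv (i + 1) (Nat.not_dvd_of_pos_of_lt (by omega) (by omega))
  have hbi := hinv (N - i) (Nat.not_dvd_of_pos_of_lt (by omega) (by omega))
  have hxai := hinv (N + 1 + (i + 1)) fun h =>
    Nat.not_dvd_of_pos_of_lt (by omega) (by omega) ((Nat.dvd_add_right dvd_rfl).1 h)
  have hbq : q ^ (N - i) ≠ 0 := pow_ne_zero _ hq0
  have heq : (1 - q ^ (N + 1 + i + 1)) * (1 - q ^ (N - i)) / (1 - q ^ (i + 1)) ^ 2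
      = -q ^ (N - i) * (1 - (1 - q ^ (N + 1)) ^ 2
        * (q ^ (i + 1) * q⁻¹ ^ (N + 1) * (1 - q ^ (i + 1))⁻¹ ^ 2)) := by
    have haq : q ^ (i + 1) ≠ 0 := pow_ne_zero _ hq0
    rw [hxa, inv_pow, inv_pow, ← hab]
    generalize q ^ (i + 1) = a at *
    generalize q ^ (N - i) = b at *
    field_simp
    ring
  refine ⟨heq, ?_, ?_, ?_, 0, O.zero_mem, by ring⟩
  · intro h
    rw [h, mul_zero] at heq
    exact div_ne_zero (mul_ne_zero hxa0 hb0) (pow_ne_zero 2 hA) heq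
  · rw [← add_assoc] at hxai
    have hu : (1 - (1 - q ^ (N + 1)) ^ 2
        * (q ^ (i + 1) * q⁻¹ ^ (N + 1) * (1 - q ^ (i + 1))⁻¹ ^ 2))⁻¹
        = -q ^ (N - i) * (1 - q ^ (i + 1)) ^ 2
          * (1 - q ^ (N + 1 + i + 1))⁻¹ * (1 - q ^ (N - i))⁻¹ := by
      refine inv_eq_of_mul_eq_one_right ?_
      rw [div_eq_iff (pow_ne_zero 2 hA)] at heq
      generalize 1 - (1 - q ^ (N + 1)) ^ 2
        * (q ^ (i + 1) * q⁻¹ ^ (N + 1) * (1 - q ^ (i + 1))⁻¹ ^ 2) = u at heq ⊢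
      field_simp
      linear_combination -heq
    rw [hu]
    exact mul_mem (mul_mem (mul_mem (neg_mem (pow_mem hqO _))
      (pow_mem (sub_mem O.one_mem (pow_mem hqO _)) 2)) hxai) hbi
  · exact mul_mem (mul_mem (pow_mem hqO _) (pow_mem hqi _)) (pow_mem hAi 2)

theorem exists_sum_sub_eq (hq0 : q ≠ 0) (hqO : q ∈ O) (hqi : q⁻¹ ∈ O)
    (hQ : ∀ c : ℚ, (c : K) ∈ O) (hne : ∀ i, 1 - q ^ (i + 1) ≠ 0)
    (hinv : ∀ j, ¬ N + 1 ∣ j → (1 - q ^ j)⁻¹ ∈ O) {I : K} (hI : (1 - q) * I = 1 - q ^ (N + 1))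
    {B : ℕ → K} (hB0 : B 0 = 1)
    (hBs : ∀ k < N, B (k + 1)
      = B k * ((1 - q ^ (N + 1 + k + 1)) * (1 - q ^ (N - k)) / (1 - q ^ (k + 1)) ^ 2)) (r : ℤ) :
    ∃ h ∈ O,
      ∑ k ∈ range (N + 1),
          q ^ (r * (((N + 1 : ℕ) : ℤ) - (k : ℤ)) ^ 2 + (r - 1) * (k : ℤ)) * B k ^ (2 * r)
        - (q ^ (((N + 1 : ℕ) : ℤ) * (((N + 1 : ℕ) : ℤ) * r - 1) + 1) * I
          + 2 * r * q ^ (((N + 1 : ℕ) : ℤ) * (((N + 1 : ℕ) : ℤ) * r - 2) + 1) * (1 - q) * I ^ 2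
            * (N / 2 + N * (N - 2) / 8 * (1 - q) * I))
        = (1 - q ^ (N + 1)) ^ 4 * h := by
  have htO : 1 - q ^ (N + 1) ∈ O := sub_mem O.one_mem (pow_mem hqO _)
  set c : ℕ → K := fun i => q ^ (i + 1) * q⁻¹ ^ (N + 1) * (1 - q ^ (i + 1))⁻¹ ^ 2 with hc
  set t := 1 - q ^ (N + 1) with ht
  have hfac := fun i (hi : i < N) => hasExpansion_factor hq0 hqO hqi hne hinv hi
  have hBsq : ∀ k ≤ N, B k ^ 2 = q ^ (2 * ((N + 1 : ℕ) : ℤ) * k - k * (k + 1))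
      * (∏ i ∈ range k, (1 - t ^ 2 * c i)) ^ 2 := by
    intro k hk
    induction k with
    | zero => simp [hB0]
    | succ k ih =>
      rw [hBs k (by omega), (hfac k (by omega)).1, mul_pow, ih (by omega), prod_range_succ]
      have hexp : q ^ (2 * ((N + 1 : ℕ) : ℤ) * ((k + 1 : ℕ) : ℤ)
            - ((k + 1 : ℕ) : ℤ) * (((k + 1 : ℕ) : ℤ) + 1))
          = q ^ (2 * ((N + 1 : ℕ) : ℤ) * k - k * (k + 1)) * (q ^ (N - k)) ^ 2 := by
        rw [← zpow_natCast, ← zpow_natCast, ← zpow_mul, ← zpow_add₀ hq0]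
        congr 1
        push_cast [Nat.cast_sub (show k ≤ N by omega)]
        ring
      rw [hexp]
      ring
  set Q := q ^ (r * ((N + 1 : ℕ) : ℤ) ^ 2) with hQdef
  have hterm : ∀ k : ℕ, ∃ h ∈ O, k < N + 1 →
      q ^ (r * (((N + 1 : ℕ) : ℤ) - (k : ℤ)) ^ 2 + (r - 1) * (k : ℤ)) * B k ^ (2 * r)
        = Q * (q⁻¹ ^ k * (1 - t ^ 2 * (2 * r * ∑ i ∈ range k, c i) + t ^ 4 * h)) := by
    intro k
    by_cases hk : k < N + 1
    · have hU := HasExpansion.prod_range (k := k) htO fun i hi => (hfac i (by omega)).2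
      obtain ⟨-, -, -, h, hh, hu⟩ := (hU.pow htO 2).zpow htO r
      refine ⟨h, hh, fun _ => ?_⟩
      have hu' : ((∏ i ∈ range k, (1 - t ^ 2 * c i)) ^ 2) ^ r
          = 1 - t ^ 2 * (2 * r * ∑ i ∈ range k, c i) + t ^ 4 * h := by
        rw [hu]
        push_cast
        ring
      have hexp : q ^ (r * (((N + 1 : ℕ) : ℤ) - (k : ℤ)) ^ 2 + (r - 1) * (k : ℤ))
          * q ^ ((2 * ((N + 1 : ℕ) : ℤ) * k - k * (k + 1)) * r) = Q * q⁻¹ ^ k := by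
        rw [← zpow_natCast q⁻¹, inv_zpow', hQdef, ← zpow_add₀ hq0, ← zpow_add₀ hq0]
        congr 1
        ring
      rw [zpow_mul, show B k ^ (2 : ℤ) = B k ^ 2 from zpow_natCast _ 2, hBsq k (by omega),
        mul_zpow, hu', ← mul_assoc, ← zpow_mul, hexp, mul_assoc]
    · exact ⟨0, O.zero_mem, fun h => absurd h hk⟩
  choose h hh hterm using hterm
  have hsum := sum_congr rfl fun k hk => hterm k (mem_range.1 hk)
  rw [← mul_sum] at hsum
  have hsplit : ∑ k ∈ range (N + 1),
        q⁻¹ ^ k * (1 - t ^ 2 * (2 * r * ∑ i ∈ range k, c i) + t ^ 4 * h k)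
      = ∑ k ∈ range (N + 1), q⁻¹ ^ k
        - t ^ 2 * (2 * r) * ∑ k ∈ range (N + 1), q⁻¹ ^ k * ∑ i ∈ range k, c i
        + t ^ 4 * ∑ k ∈ range (N + 1), q⁻¹ ^ k * h k := by
    rw [mul_sum, mul_sum, ← sum_sub_distrib, ← sum_add_distrib]
    exact sum_congr rfl fun k _ => by ring
  have hgeom := one_sub_mul_sum_range_inv_pow hq0 (N + 1)
  have hdouble := one_sub_mul_sum_range_inv_pow_mul_sum hq0 c N
  have hq1 : 1 - q ≠ 0 := by simpa using hne 0
  have hx : q⁻¹ ^ (N + 1) * q ^ (N + 1) = 1 := by rw [← mul_pow, inv_mul_cancel₀ hq0, one_pow]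
  obtain ⟨G, hG, hsecond⟩ : ∃ G ∈ O,
      ∑ i ∈ range N, (q ^ (i + 1) - q ^ (N + 1)) * (1 - q ^ (i + 1))⁻¹ ^ 2
        = -((N : K) / 2 + N * (N - 2) / 8 * t) + t ^ 2 * ((1 - q) * G) := by
    rcases Nat.eq_zero_or_pos N with rfl | hN
    · exact ⟨0, O.zero_mem, by simp⟩
    · obtain ⟨G, hG, h⟩ := exists_sum_second_order_eq hqO hQ hne fun i (hi : i < N) =>
        hinv (i + 1) (Nat.not_dvd_of_pos_of_lt (by omega) (by omega))
      have h1 := hinv 1 (Nat.not_dvd_of_pos_of_lt (by omega) (by omega))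
      rw [pow_one] at h1
      exact ⟨(1 - q)⁻¹ * G, mul_mem h1 hG, by rw [h, mul_inv_cancel_left₀ hq1]⟩
  have hrewrite : ∑ i ∈ range N, c i * (q * (q⁻¹ ^ (N + 1) - q⁻¹ ^ (i + 1)))
      = q * q⁻¹ ^ (N + 1) * q⁻¹ ^ (N + 1)
        * ∑ i ∈ range N, (q ^ (i + 1) - q ^ (N + 1)) * (1 - q ^ (i + 1))⁻¹ ^ 2 := by
    rw [mul_sum]
    refine sum_congr rfl fun i _ => ?_
    have ha : q⁻¹ ^ (i + 1) * q ^ (i + 1) = 1 := by rw [← mul_pow, inv_mul_cancel₀ hq0, one_pow]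
    rw [hc]
    linear_combination
      q * q⁻¹ ^ (N + 1) * (1 - q ^ (i + 1))⁻¹ ^ 2 * (q⁻¹ ^ (N + 1) * hx - ha
        + (1 - q⁻¹ ^ (N + 1)) * hx)
  rw [hrewrite, hsecond] at hdouble
  have hE1 : q ^ (((N + 1 : ℕ) : ℤ) * (((N + 1 : ℕ) : ℤ) * r - 1) + 1)
      = Q * q⁻¹ ^ (N + 1) * q := by
    rw [hQdef, ← zpow_natCast, inv_zpow', ← zpow_add₀ hq0, ← zpow_add_one₀ hq0]
    congr 1
    ring
  have hE2 : q ^ (((N + 1 : ℕ) : ℤ) * (((N + 1 : ℕ) : ℤ) * r - 2) + 1)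
      = Q * q⁻¹ ^ (N + 1) * q⁻¹ ^ (N + 1) * q := by
    rw [hQdef, ← zpow_natCast, inv_zpow', ← zpow_add₀ hq0, ← zpow_add₀ hq0, ← zpow_add_one₀ hq0]
    congr 1
    ring
  have hQO : Q ∈ O := zpow_mem_of_inv_mem hqO hqi _
  have hrO : (2 * r : K) ∈ O := by simpa using hQ (2 * r)
  refine ⟨Q * ∑ k ∈ range (N + 1), q⁻¹ ^ k * h k
      - 2 * r * Q * (q * q⁻¹ ^ (N + 1) * q⁻¹ ^ (N + 1)) * G, sub_mem
      (mul_mem hQO (sum_mem fun k _ => mul_mem (pow_mem hqi k) (hh k)))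
      (mul_mem (mul_mem (mul_mem hrO hQO)
        (mul_mem (mul_mem hqO (pow_mem hqi _)) (pow_mem hqi _))) hG), ?_⟩
  rw [hsum, hsplit, hE1, hE2]
  refine mul_left_cancel₀ hq1 ?_
  generalize ∑ k ∈ range (N + 1), q⁻¹ ^ k = S at *
  generalize ∑ k ∈ range (N + 1), q⁻¹ ^ k * ∑ i ∈ range k, c i = D at *
  generalize ∑ k ∈ range (N + 1), q⁻¹ ^ k * h k = H at *
  have hxt : q ^ (N + 1) = 1 - t := by rw [ht]; ring
  rw [hxt] at hx
  rw [show (N : K) * (N - 2) / 8 * (1 - q) * I = N * (N - 2) / 8 * t by rw [← hI]; ring]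
  have hI2 : (1 - q) * ((1 - q) * I ^ 2) = t ^ 2 := by rw [← hI]; ring
  generalize q⁻¹ ^ (N + 1) = w at *
  clear_value t Q
  linear_combination Q * hgeom - Q * t ^ 2 * (2 * r) * hdouble - Q * w * q * hI
    - 2 * r * (Q * w * w * q) * (N / 2 + N * (N - 2) / 8 * t) * hI2 + Q * q * hx

end Regular

/-- The ring of rational functions with a denominator coprime to `P`. -/
noncomputable def regularSubring (P : ℚ[X]) : Subring (RatFunc ℚ) where
  carrier := {f | ∃ a b : ℚ[X], b ≠ 0 ∧ IsCoprime b P ∧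
    f = algebraMap ℚ[X] (RatFunc ℚ) a / algebraMap ℚ[X] (RatFunc ℚ) b}
  one_mem' := ⟨1, 1, one_ne_zero, isCoprime_one_left, by simp⟩
  zero_mem' := ⟨0, 1, one_ne_zero, isCoprime_one_left, by simp⟩
  mul_mem' := by
    rintro _ _ ⟨a, b, hb0, hb, rfl⟩ ⟨c, d, hd0, hd, rfl⟩
    refine ⟨a * c, b * d, mul_ne_zero hb0 hd0, hb.mul_left hd, ?_⟩
    rw [map_mul, map_mul, div_mul_div_comm]
  add_mem' := by
    rintro _ _ ⟨a, b, hb0, hb, rfl⟩ ⟨c, d, hd0, hd, rfl⟩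
    refine ⟨a * d + b * c, b * d, mul_ne_zero hb0 hd0, hb.mul_left hd, ?_⟩
    rw [div_add_div _ _ (RatFunc.algebraMap_ne_zero hb0) (RatFunc.algebraMap_ne_zero hd0)]
    simp only [map_mul, map_add]
  neg_mem' := by
    rintro _ ⟨a, b, hb0, hb, rfl⟩
    exact ⟨-a, b, hb0, hb, by rw [map_neg, neg_div]⟩

theorem algebraMap_mem_regularSubring (P a : ℚ[X]) :
    algebraMap ℚ[X] (RatFunc ℚ) a ∈ regularSubring P :=
  ⟨a, 1, one_ne_zero, isCoprime_one_left, by simp⟩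

theorem inv_algebraMap_mem_regularSubring {P b : ℚ[X]} (hb0 : b ≠ 0) (hb : IsCoprime b P) :
    (algebraMap ℚ[X] (RatFunc ℚ) b)⁻¹ ∈ regularSubring P :=
  ⟨1, b, hb0, hb, by simp⟩

theorem ratModEq_pow_of_sub_eq {P : ℚ[X]} {m : ℕ} {A B h : RatFunc ℚ} {u : ℚ[X]}
    (hu : P ∣ u) (hh : h ∈ regularSubring P)
    (hAB : A - B = algebraMap ℚ[X] (RatFunc ℚ) u ^ m * h) : ratModEq (P ^ m) A B := by
  obtain ⟨a, b, -, hb, rfl⟩ := hh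
  refine ⟨u ^ m * a, b, hb.pow_right, (pow_dvd_pow_of_dvd hu m).mul_right a, ?_⟩
  rw [hAB, map_mul, map_pow, mul_div_assoc]

theorem isCoprime_one_sub_X_pow_cyclotomic {n j : ℕ} (h : ¬ n ∣ j) :
    IsCoprime (1 - X ^ j : ℚ[X]) (cyclotomic n ℚ) := by
  have hj : 0 < j := Nat.pos_of_ne_zero fun h0 => h (h0 ▸ dvd_zero n)
  rw [← neg_sub, IsCoprime.neg_left_iff, ← prod_cyclotomic_eq_X_pow_sub_one hj ℚ]
  refine IsCoprime.prod_left fun d hd => cyclotomic.isCoprime_rat ?_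
  rintro rfl
  exact h (Nat.dvd_of_mem_divisors hd)

theorem one_sub_X_pow_succ_ne_zero (i : ℕ) : (1 - X ^ (i + 1) : ℚ[X]) ≠ 0 := by
  rw [← neg_sub, neg_ne_zero]
  exact X_pow_sub_C_ne_zero i.succ_pos 1

theorem one_sub_q_pow (j : ℕ) :
    1 - q ^ j = algebraMap ℚ[X] (RatFunc ℚ) (1 - X ^ j) := by
  simp [q]

theorem one_sub_q_pow_succ_ne_zero (i : ℕ) : 1 - q ^ (i + 1) ≠ 0 := by
  rw [one_sub_q_pow]
  exact RatFunc.algebraMap_ne_zero (one_sub_X_pow_succ_ne_zero i)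

theorem one_sub_q_mul_qintR (n : ℕ) : (1 - q) * qintR n = 1 - q ^ n := by
  rw [one_sub_q_pow, qintR, qint, ← mul_neg_geom_sum, map_mul]
  simp [q]

theorem qPoch_ne_zero (m : ℕ) : qPoch m ≠ 0 :=
  prod_ne_zero_iff.2 fun i _ => one_sub_q_pow_succ_ne_zero i

theorem qPoch_succ (m : ℕ) : qPoch (m + 1) = qPoch m * (1 - q ^ (m + 1)) :=
  prod_range_succ _ _

theorem qbinom_mul_qbinom_succ {N k : ℕ} (hk : k < N) :
    qbinom (N + 1 + (k + 1)) (k + 1) * qbinom N (k + 1)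
      = qbinom (N + 1 + k) k * qbinom N k
        * ((1 - q ^ (N + 1 + k + 1)) * (1 - q ^ (N - k)) / (1 - q ^ (k + 1)) ^ 2) := by
  obtain ⟨m, rfl⟩ : ∃ m, N = k + m + 1 := ⟨N - k - 1, by omega⟩
  have e1 : k + m + 1 + 1 + (k + 1) - (k + 1) = k + m + 1 + 1 := by omega
  have e2 : k + m + 1 - (k + 1) = m := by omega
  have e3 : k + m + 1 + 1 + k - k = k + m + 1 + 1 := by omega
  have e4 : k + m + 1 - k = m + 1 := by omega
  rw [qbinom, qbinom, qbinom, qbinom, if_pos (by omega), if_pos (by omega), if_pos (by omega),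
    if_pos (by omega), e1, e2, e3, e4, ← add_assoc _ k 1, qPoch_succ (k + m + 1 + 1 + k),
    qPoch_succ k, qPoch_succ m]
  have h1 := qPoch_ne_zero k
  have h2 := qPoch_ne_zero m
  have h3 := qPoch_ne_zero (k + m + 1 + 1)
  have h4 := one_sub_q_pow_succ_ne_zero k
  have h5 := one_sub_q_pow_succ_ne_zero m
  generalize 1 - q ^ (k + 1) = a at *
  generalize 1 - q ^ (m + 1) = b at *
  field_simp

/-- Equation (2.7): for a positive integer `n` and an arbitrary integer `r`,
`∑_{k=0}^{n-1} q^{r(n-k)²+(r-1)k} [n+k choose k]^{2r} [n-1 choose k]^{2r}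
  ≡ q^{n(nr-1)+1}[n] + 2r q^{n(nr-2)+1}(1-q)[n]²
      ((n-1)/2 + (n-1)(n-3)(1-q)[n]/8)  (mod Φ_n(q)⁴)`. -/
theorem sum_intermediate_mod_cyclotomic_pow_four (n : ℕ) (hn : 0 < n) (r : ℤ) :
    ratModEq ((Polynomial.cyclotomic n ℚ) ^ 4)
      (∑ k ∈ Finset.range n,
        q ^ (r * ((n : ℤ) - (k : ℤ)) ^ 2 + (r - 1) * (k : ℤ)) *
          qbinom (n + k) k ^ (2 * r) * qbinom (n - 1) k ^ (2 * r))
      (q ^ ((n : ℤ) * ((n : ℤ) * r - 1) + 1) * qintR n +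
        RatFunc.C ((2 * r : ℤ) : ℚ) * q ^ ((n : ℤ) * ((n : ℤ) * r - 2) + 1) * (1 - q) *
          qintR n ^ 2 *
          (RatFunc.C (((n : ℚ) - 1) / 2) +
            RatFunc.C (((n : ℚ) - 1) * ((n : ℚ) - 3) / 8) * (1 - q) * qintR n)) := by
  obtain ⟨N, rfl⟩ : ∃ N, n = N + 1 := ⟨n - 1, by omega⟩
  have hq0 : q ≠ 0 := RatFunc.X_ne_zero
  have hq : q = algebraMap ℚ[X] (RatFunc ℚ) X := RatFunc.algebraMap_X.symm
  let O := regularSubring (cyclotomic (N + 1) ℚ)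
  have hqO : q ∈ O := hq ▸ algebraMap_mem_regularSubring _ X
  have hX : IsCoprime (X : ℚ[X]) (cyclotomic (N + 1) ℚ) := by
    refine IsCoprime.of_isCoprime_of_dvd_right (y := X ^ (N + 1) - 1) ?_
      (cyclotomic.dvd_X_pow_sub_one _ _)
    exact ⟨X ^ N, -1, by ring⟩
  have hqi : q⁻¹ ∈ O := hq ▸ inv_algebraMap_mem_regularSubring X_ne_zero hX
  have hQ : ∀ c : ℚ, (c : RatFunc ℚ) ∈ O := fun c => by
    have := algebraMap_mem_regularSubring (cyclotomic (N + 1) ℚ) (C c)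
    rwa [RatFunc.algebraMap_C, eq_ratCast] at this
  have hinv : ∀ j, ¬ N + 1 ∣ j → (1 - q ^ j)⁻¹ ∈ O := fun j hj => by
    obtain ⟨i, rfl⟩ := Nat.exists_eq_succ_of_ne_zero fun h0 : j = 0 => hj (h0 ▸ dvd_zero _)
    rw [one_sub_q_pow]
    exact inv_algebraMap_mem_regularSubring (one_sub_X_pow_succ_ne_zero i)
      (isCoprime_one_sub_X_pow_cyclotomic hj)
  obtain ⟨h, hh, heq⟩ := exists_sum_sub_eq (B := fun k => qbinom (N + 1 + k) k * qbinom N k)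
    hq0 hqO hqi hQ one_sub_q_pow_succ_ne_zero hinv (one_sub_q_mul_qintR (N + 1))
    (by simp [qbinom, show qPoch 0 = 1 from prod_range_zero _, qPoch_ne_zero])
    (fun k hk => qbinom_mul_qbinom_succ hk) r
  have hdvd : cyclotomic (N + 1) ℚ ∣ 1 - X ^ (N + 1) := by
    rw [← neg_sub, dvd_neg]
    exact cyclotomic.dvd_X_pow_sub_one _ _
  refine ratModEq_pow_of_sub_eq hdvd hh ?_
  rw [← one_sub_q_pow, ← heq]
  simp only [eq_ratCast, add_tsub_cancel_right, mul_zpow]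
  push_cast
  congr 1
  · exact sum_congr rfl fun k _ => by ring
  · ring
end
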